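/- arXiv:math/0512438 — 3 statements merged into one kernel-verified Lean document; each statement's English description precedes it below -/
import Mathlib

section
/- Let Λ be a row-finite locally convex k-graph. Suppose g : Λ⁰ → [0,∞) satisfies g(v) = Σ_{e ∈ vΛ^{e_i}} g(s(e)) for every vertex v ∈ Λ⁰ and every 1 ≤ i ≤ k such that vΛ^{e_i} ≠ ∅. Then g is a k-graph trace on Λ, i.e. g(v) = Σ_{λ ∈ vΛ^{≤n}} g(s(λ)) for all v ∈ Λ⁰ and all n ∈ ℕ^k. -/
open scoped BigOperators ENNReal NNReal

/-- A `k`-graph: a countable small category `Λ` together with a degree functor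
`d : Λ → ℕ^k` satisfying the factorisation property.  Objects are identified with
the identity morphisms, i.e. the paths of degree `0`. -/
structure KGraph (k : ℕ) where
  /-- The morphisms ("paths") of the category. -/
  Path : Type
  countable : Countable Path
  /-- The degree functor. -/
  d : Path → Fin k → ℕ
  /-- The range (codomain) of a path, as an identity morphism. -/
  r : Path → Path
  /-- The source (domain) of a path, as an identity morphism. -/
  s : Path → Path
  /-- Composition `μν` of paths with `s μ = r ν`. -/
  comp : (μ ν : Path) → s μ = r ν → Path
  d_r : ∀ lam : Path, d (r lam) = 0
  d_s : ∀ lam : Path, d (s lam) = 0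
  /-- Paths of degree zero are identity morphisms, identified with their range. -/
  vertex_r : ∀ v : Path, d v = 0 → r v = v
  vertex_s : ∀ v : Path, d v = 0 → s v = v
  r_comp : ∀ (μ ν : Path) (h : s μ = r ν), r (comp μ ν h) = r μ
  s_comp : ∀ (μ ν : Path) (h : s μ = r ν), s (comp μ ν h) = s ν
  d_comp : ∀ (μ ν : Path) (h : s μ = r ν), d (comp μ ν h) = d μ + d ν
  comp_assoc : ∀ (lam μ ν : Path) (h₁ : s lam = r μ) (h₂ : s μ = r ν)
      (h₃ : s (comp lam μ h₁) = r ν) (h₄ : s lam = r (comp μ ν h₂)),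
      comp (comp lam μ h₁) ν h₃ = comp lam (comp μ ν h₂) h₄
  id_comp : ∀ (lam : Path) (h : s (r lam) = r lam), comp (r lam) lam h = lam
  comp_id : ∀ (lam : Path) (h : s lam = r (s lam)), comp lam (s lam) h = lam
  /-- The factorisation property. -/
  factor : ∀ (lam : Path) (m n : Fin k → ℕ), d lam = m + n →
      ∃! p : Path × Path, ∃ h : s p.1 = r p.2,
        d p.1 = m ∧ d p.2 = n ∧ comp p.1 p.2 h = lam

namespace KGraph

variable {k : ℕ} (Λ : KGraph k)

/-- A vertex is a path of degree `0`. -/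
def IsVertex (v : Λ.Path) : Prop := Λ.d v = 0

/-- The set `vΛⁿ` of paths of degree `n` with range `v`. -/
def paths (v : Λ.Path) (n : Fin k → ℕ) : Set Λ.Path :=
  {lam | Λ.d lam = n ∧ Λ.r lam = v}

/-- The set `Λⁿv` of paths of degree `n` with source `v`. -/
def pathsTo (v : Λ.Path) (n : Fin k → ℕ) : Set Λ.Path :=
  {lam | Λ.d lam = n ∧ Λ.s lam = v}

/-- The set `Λ^{≤ n}`. -/
def lePaths (n : Fin k → ℕ) : Set Λ.Path :=
  {lam | Λ.d lam ≤ n ∧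
    ∀ (μ : Λ.Path) (_ : Λ.s lam = Λ.r μ), Λ.d lam + Λ.d μ ≤ n → μ = Λ.s lam}

/-- The set `vΛ^{≤ n}`. -/
def vLePaths (v : Λ.Path) (n : Fin k → ℕ) : Set Λ.Path :=
  {lam | lam ∈ Λ.lePaths n ∧ Λ.r lam = v}

/-- `Λ` is row-finite if each `vΛⁿ` is finite. -/
def RowFinite : Prop := ∀ (v : Λ.Path) (n : Fin k → ℕ), (Λ.paths v n).Finite

/-- `Λ` is locally finite if it is row-finite and each `Λⁿv` is finite. -/
def LocallyFinite : Prop :=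
  Λ.RowFinite ∧ ∀ (v : Λ.Path) (n : Fin k → ℕ), (Λ.pathsTo v n).Finite

/-- `Λ` has no sinks if each `Λⁿv` is nonempty. -/
def NoSinks : Prop :=
  ∀ (v : Λ.Path), Λ.IsVertex v → ∀ n : Fin k → ℕ, (Λ.pathsTo v n).Nonempty

/-- `Λ` has no sources if each `vΛⁿ` is nonempty. -/
def NoSources : Prop :=
  ∀ (v : Λ.Path), Λ.IsVertex v → ∀ n : Fin k → ℕ, (Λ.paths v n).Nonempty

/-- `Λ` is locally convex. -/
def LocallyConvex : Prop :=
  ∀ (i j : Fin k), i ≠ j → ∀ e : Λ.Path, Λ.d e = Pi.single i 1 →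
    Λ.paths (Λ.s e) (Pi.single j 1) = ∅ → Λ.paths (Λ.r e) (Pi.single j 1) = ∅

/-- A `k`-graph trace on `Λ`: a function `g : Λ⁰ → [0,∞)` (extended arbitrarily to
all paths) with `g v = Σ_{λ ∈ vΛ^{≤n}} g (s λ)` for every vertex `v` and `n ∈ ℕ^k`. -/
def IsGraphTrace (g : Λ.Path → ℝ) : Prop :=
  (∀ v : Λ.Path, Λ.IsVertex v → 0 ≤ g v) ∧
  ∀ (v : Λ.Path), Λ.IsVertex v → ∀ (n : Fin k → ℕ) (F : Finset Λ.Path),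
    ↑F = Λ.vLePaths v n → g v = ∑ lam ∈ F, g (Λ.s lam)

/-- Two paths are orthogonal if they have no common extension. -/
def Orthogonal (μ ν : Λ.Path) : Prop :=
  ¬ ∃ (α β : Λ.Path) (h₁ : Λ.s μ = Λ.r α) (h₂ : Λ.s ν = Λ.r β),
      Λ.comp μ α h₁ = Λ.comp ν β h₂

end KGraph

/-- A boundary path of degree `m ∈ (ℕ ∪ {∞})^k` in a `k`-graph `Λ`. -/
structure KGraph.BoundaryPath {k : ℕ} (Λ : KGraph k) where
  /-- The degree of the boundary path. -/
  deg : Fin k → ℕ∞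
  /-- The segment `x(p,q)` for `p ≤ q ≤ deg`. -/
  seg : (Fin k → ℕ) → (Fin k → ℕ) → Λ.Path
  seg_d : ∀ p q : Fin k → ℕ, p ≤ q → (∀ i, (q i : ℕ∞) ≤ deg i) →
    Λ.d (seg p q) = q - p
  seg_r : ∀ p q : Fin k → ℕ, p ≤ q → (∀ i, (q i : ℕ∞) ≤ deg i) →
    Λ.r (seg p q) = seg p p
  seg_s : ∀ p q : Fin k → ℕ, p ≤ q → (∀ i, (q i : ℕ∞) ≤ deg i) →
    Λ.s (seg p q) = seg q q
  seg_comp : ∀ p q t : Fin k → ℕ, p ≤ q → q ≤ t → (∀ i, (t i : ℕ∞) ≤ deg i) →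
    ∀ h : Λ.s (seg p q) = Λ.r (seg q t), Λ.comp (seg p q) (seg q t) h = seg p t
  boundary : ∀ (i : Fin k) (n : Fin k → ℕ), (∀ j, (n j : ℕ∞) ≤ deg j) →
    (n i : ℕ∞) = deg i → Λ.paths (seg n n) (Pi.single i 1) = ∅

namespace KGraph

variable {k : ℕ} (Λ : KGraph k)

/-- An end of `Λ`: a boundary path `x` with `r(x)Λⁿ = {x(0,n)}` for all `n ≤ d(x)`. -/
def IsEnd (x : Λ.BoundaryPath) : Prop :=
  ∀ n : Fin k → ℕ, (∀ i, (n i : ℕ∞) ≤ x.deg i) →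
    Λ.paths (x.seg 0 0) n = {x.seg 0 n}

/-- A vertex `v` lies on the boundary path `x` if `v = x(n)` for some `n ≤ d(x)`. -/
def LiesOn (v : Λ.Path) (x : Λ.BoundaryPath) : Prop :=
  ∃ n : Fin k → ℕ, (∀ i, (n i : ℕ∞) ≤ x.deg i) ∧ v = x.seg n n

/-- Two ends are equivalent if they pass through a common vertex. -/
def EndEquiv (x y : Λ.BoundaryPath) : Prop :=
  ∃ (n m : Fin k → ℕ), (∀ i, (n i : ℕ∞) ≤ x.deg i) ∧ (∀ i, (m i : ℕ∞) ≤ y.deg i) ∧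
    x.seg n n = y.seg m m

end KGraph

/-- A Cuntz–Krieger `Λ`-family in a `C*`-algebra `A`. -/
structure CKFamily {k : ℕ} (Λ : KGraph k) (A : Type*) [NormedRing A] [StarRing A] where
  /-- The partial isometries `s_λ`. -/
  S : Λ.Path → A
  partial_isom : ∀ lam : Λ.Path, S lam * star (S lam) * S lam = S lam
  vertex_star : ∀ v : Λ.Path, Λ.IsVertex v → star (S v) = S v
  vertex_idem : ∀ v : Λ.Path, Λ.IsVertex v → S v * S v = S v
  vertex_orth : ∀ v w : Λ.Path, Λ.IsVertex v → Λ.IsVertex w → v ≠ w → S v * S w = 0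
  comp_mul : ∀ (μ ν : Λ.Path) (h : Λ.s μ = Λ.r ν), S μ * S ν = S (Λ.comp μ ν h)
  star_mul_self : ∀ lam : Λ.Path, star (S lam) * S lam = S (Λ.s lam)
  cuntz_krieger : ∀ (v : Λ.Path), Λ.IsVertex v → ∀ (n : Fin k → ℕ) (F : Finset Λ.Path),
    ↑F = Λ.vLePaths v n → S v = ∑ lam ∈ F, S lam * star (S lam)

/-- A trace on a `C*`-algebra `A`: a map `τ : A⁺ → [0,∞]` (extended arbitrarily to `A`)
which is additive and positively homogeneous on the positive cone and tracial. -/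
structure CstarTrace (A : Type*) [NormedRing A] [StarRing A] [PartialOrder A]
    [Module ℝ A] where
  /-- The underlying map. -/
  τ : A → ℝ≥0∞
  map_add : ∀ a b : A, 0 ≤ a → 0 ≤ b → τ (a + b) = τ a + τ b
  map_smul : ∀ (c : ℝ) (a : A), 0 ≤ c → 0 ≤ a → τ (c • a) = ENNReal.ofReal c * τ a
  tracial : ∀ a : A, τ (star a * a) = τ (a * star a)

namespace KGraph

variable {k : ℕ} (Λ : KGraph k)

theorem exists_eq_add_single {n : Fin k → ℕ} {i : Fin k} (hi : n i ≠ 0) :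
    ∃ m : Fin k → ℕ, n = Pi.single i 1 + m := by
  refine ⟨n - Pi.single i 1, (add_tsub_cancel_of_le fun j => ?_).symm⟩
  by_cases hj : j = i
  · subst hj
    simpa using Nat.one_le_iff_ne_zero.mpr hi
  · simp [hj]

theorem lt_single_add (m : Fin k → ℕ) (i : Fin k) : m < Pi.single i 1 + m := by
  refine lt_of_le_of_ne (fun j => by simp) fun h => ?_
  have := congrFun h i
  simp at this

/-- A path whose degree has positive `i`-th coordinate starts with an edge of colour `i`. -/
theorem exists_edge_comp (lam : Λ.Path) {i : Fin k} (hi : Λ.d lam i ≠ 0) :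
    ∃ (e μ : Λ.Path) (h : Λ.s e = Λ.r μ), Λ.d e = Pi.single i 1 ∧
      Λ.comp e μ h = lam := by
  obtain ⟨m, hm⟩ := exists_eq_add_single hi
  obtain ⟨⟨e, μ⟩, ⟨h, he, -, hc⟩, -⟩ := Λ.factor lam _ _ hm
  exact ⟨e, μ, h, he, hc⟩

/-- Composition is cancellative once the degree of the initial segment is fixed. -/
theorem comp_injective {e μ e' μ' : Λ.Path} (h : Λ.s e = Λ.r μ) (h' : Λ.s e' = Λ.r μ')
    (hd : Λ.d e = Λ.d e') (hc : Λ.comp e μ h = Λ.comp e' μ' h') : e = e' ∧ μ = μ' := by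
  have hμ : Λ.d μ' = Λ.d μ := by
    have := Λ.d_comp e μ h
    rw [hc, Λ.d_comp, hd] at this
    exact add_left_cancel this
  obtain ⟨p, -, hp⟩ := Λ.factor (Λ.comp e μ h) _ _ (Λ.d_comp e μ h)
  have h₁ := hp (e, μ) ⟨h, rfl, rfl, rfl⟩
  have h₂ := hp (e', μ') ⟨h', hd.symm, hμ, hc.symm⟩
  exact Prod.mk.inj (h₁.trans h₂.symm)

/-- In a locally convex graph, the existence of an edge of colour `i` propagates along
paths whose degree vanishes in the coordinate `i`. -/
theorem LocallyConvex.paths_source_nonempty {Λ : KGraph k} (hlc : Λ.LocallyConvex)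
    {i : Fin k} (lam : Λ.Path) (hi : Λ.d lam i = 0)
    (hr : (Λ.paths (Λ.r lam) (Pi.single i 1)).Nonempty) :
    (Λ.paths (Λ.s lam) (Pi.single i 1)).Nonempty := by
  induction hn : Λ.d lam using WellFoundedLT.induction generalizing lam with
  | ind n ih =>
    subst hn
    by_cases h0 : Λ.d lam = 0
    · rwa [Λ.vertex_s lam h0, ← Λ.vertex_r lam h0]
    · obtain ⟨j, hj⟩ := Function.ne_iff.mp h0
      obtain ⟨e, μ, h, he, rfl⟩ := Λ.exists_edge_comp lam hj
      have hd := Λ.d_comp e μ h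
      rw [he] at hd
      have hij : j ≠ i := by
        rintro rfl
        exact hj hi
      rw [Λ.r_comp] at hr
      rw [Λ.s_comp]
      refine ih (Λ.d μ) (hd ▸ lt_single_add _ _) μ ?_ ?_ rfl
      · have := congrFun hd i
        rw [hi] at this
        simpa [hij.symm] using this.symm
      · rw [← h]
        by_contra hne
        rw [Set.not_nonempty_iff_eq_empty] at hne
        exact hr.ne_empty (hlc j i hij e he hne)

theorem RowFinite.finite_vLePaths {Λ : KGraph k} (hrf : Λ.RowFinite) (v : Λ.Path)
    (n : Fin k → ℕ) : (Λ.vLePaths v n).Finite :=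
  ((Set.finite_Iic n).biUnion fun m _ => hrf v m).subset fun lam h =>
    Set.mem_biUnion (x := Λ.d lam) h.1.1 ⟨rfl, h.2⟩

/-- If no edge of a colour occurring in `n` has range `v`, then `vΛ^{≤ n} = {v}`. -/
theorem vLePaths_eq_singleton {v : Λ.Path} (hv : Λ.IsVertex v) {n : Fin k → ℕ}
    (h : ∀ i, n i ≠ 0 → Λ.paths v (Pi.single i 1) = ∅) : Λ.vLePaths v n = {v} := by
  have key : ∀ μ : Λ.Path, Λ.r μ = v → Λ.d μ ≤ n → μ = v := by
    intro μ hμ hle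
    by_cases h0 : Λ.d μ = 0
    · rw [← hμ, Λ.vertex_r μ h0]
    · obtain ⟨j, hj⟩ := Function.ne_iff.mp h0
      have hj' : Λ.d μ j ≠ 0 := hj
      obtain ⟨e, ν, hc, he, rfl⟩ := Λ.exists_edge_comp μ hj'
      have hnj : n j ≠ 0 := fun hz => hj' (Nat.le_zero.mp (hz ▸ hle j))
      have : e ∈ Λ.paths v (Pi.single j 1) := ⟨he, by rw [← hμ, Λ.r_comp]⟩
      rw [h j hnj] at this
      exact this.elim
  have hv' : Λ.d v = 0 := hv
  ext lam
  constructor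
  · intro hl
    exact key lam hl.2 hl.1.1
  · rintro rfl
    refine ⟨⟨by rw [hv']; exact zero_le, fun μ hμ hle => ?_⟩, Λ.vertex_r _ hv⟩
    rw [Λ.vertex_s _ hv] at hμ ⊢
    exact key μ hμ.symm (by simpa [hv'] using hle)

theorem comp_mem_lePaths_iff {e μ : Λ.Path} (h : Λ.s e = Λ.r μ) (n : Fin k → ℕ) :
    Λ.comp e μ h ∈ Λ.lePaths (Λ.d e + n) ↔ μ ∈ Λ.lePaths n := by
  simp only [lePaths, Set.mem_ofPred_eq, Λ.d_comp, Λ.s_comp, add_assoc, add_le_add_iff_left]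

/-- In a locally convex graph, paths in `vΛ^{≤ n}` with `n i ≠ 0` use the colour `i`
whenever `v` receives an edge of that colour. -/
theorem LocallyConvex.d_ne_zero_of_mem_vLePaths {Λ : KGraph k} (hlc : Λ.LocallyConvex)
    {v lam : Λ.Path} {n : Fin k → ℕ} {i : Fin k} (hi : n i ≠ 0)
    (hv : (Λ.paths v (Pi.single i 1)).Nonempty) (hl : lam ∈ Λ.vLePaths v n) :
    Λ.d lam i ≠ 0 := by
  intro h0
  obtain ⟨⟨hle, hmax⟩, rfl⟩ := hl
  obtain ⟨f, hf, hfr⟩ := hlc.paths_source_nonempty lam h0 hv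
  have hfs : f = Λ.s lam := by
    refine hmax f hfr.symm fun j => ?_
    rw [hf]
    by_cases hj : j = i
    · subst hj
      simpa [h0] using Nat.one_le_iff_ne_zero.mpr hi
    · simpa [hj] using hle j
  have := congrFun (Λ.d_s lam) i
  rw [← hfs, hf] at this
  simp at this

end KGraph

/-- A nonnegative vertex function satisfying the edge-sum condition for every colour
`i` with `vΛ^{e_i} ≠ ∅` is a graph trace. -/
theorem graph_trace_of_edge_condition
    {k : ℕ} (Λ : KGraph k) (hrf : Λ.RowFinite) (hlc : Λ.LocallyConvex)
    (g : Λ.Path → ℝ) (hnonneg : ∀ v : Λ.Path, Λ.IsVertex v → 0 ≤ g v)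
    (hedge : ∀ v : Λ.Path, Λ.IsVertex v → ∀ i : Fin k,
      (Λ.paths v (Pi.single i 1)).Nonempty →
      ∀ F : Finset Λ.Path, ↑F = Λ.paths v (Pi.single i 1) →
        g v = ∑ e ∈ F, g (Λ.s e)) :
    Λ.IsGraphTrace g := by
  classical
  refine ⟨hnonneg, fun v hv n => ?_⟩
  induction n using WellFoundedLT.induction generalizing v with
  | ind n ih =>
    intro F hF
    by_cases hex : ∃ i, n i ≠ 0 ∧ (Λ.paths v (Pi.single i 1)).Nonempty
    · obtain ⟨i, hi, hne⟩ := hex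
      obtain ⟨m, rfl⟩ := KGraph.exists_eq_add_single hi
      have hE := (hrf v (Pi.single i 1)).coe_toFinset
      have hT := fun w => (hrf.finite_vLePaths w m).coe_toFinset
      set E := (hrf v (Pi.single i 1)).toFinset
      set T := fun w => (hrf.finite_vLePaths w m).toFinset
      have memE : ∀ e, e ∈ E ↔ e ∈ Λ.paths v (Pi.single i 1) := fun e => by
        rw [← hE, Finset.mem_coe]
      have memT : ∀ w μ, μ ∈ T w ↔ μ ∈ Λ.vLePaths w m := fun w μ => by
        rw [← hT, Finset.mem_coe]
      have memF : ∀ lam, lam ∈ F ↔ lam ∈ Λ.vLePaths v (Pi.single i 1 + m) := fun lam => by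
        rw [← hF, Finset.mem_coe]
      rw [hedge v hv i hne E hE, Finset.sum_congr rfl fun e _ =>
        ih m (KGraph.lt_single_add m i) (Λ.s e) (Λ.d_s e) (T (Λ.s e)) (hT _), Finset.sum_sigma']
      have mem : ∀ a ∈ E.sigma fun e => T (Λ.s e),
          Λ.d a.1 = Pi.single i 1 ∧ Λ.r a.1 = v ∧ a.2 ∈ Λ.lePaths m ∧ Λ.s a.1 = Λ.r a.2 := by
        intro a ha
        obtain ⟨h₁, h₂⟩ := Finset.mem_sigma.mp ha
        rw [memE] at h₁
        rw [memT] at h₂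
        exact ⟨h₁.1, h₁.2, h₂.1, h₂.2.symm⟩
      refine Finset.sum_bij (fun a ha => Λ.comp a.1 a.2 (mem a ha).2.2.2) ?_ ?_ ?_ ?_
      · intro a ha
        obtain ⟨hd, hr, hle, h⟩ := mem a ha
        have hc := (Λ.comp_mem_lePaths_iff h m).mpr hle
        rw [memF]
        exact ⟨by simpa only [hd] using hc, by rw [Λ.r_comp, hr]⟩
      · rintro ⟨e, μ⟩ ha ⟨e', μ'⟩ hb hc
        obtain ⟨rfl, rfl⟩ := Λ.comp_injective _ _ ((mem _ ha).1.trans (mem _ hb).1.symm) hc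
        rfl
      · intro lam hlam
        rw [memF] at hlam
        obtain ⟨e, μ, h, he, rfl⟩ :=
          Λ.exists_edge_comp lam (hlc.d_ne_zero_of_mem_vLePaths hi hne hlam)
        rw [← he] at hlam
        refine ⟨⟨e, μ⟩, Finset.mem_sigma.mpr ⟨(memE _).mpr ⟨he, ?_⟩, (memT _ _).mpr ⟨?_, h.symm⟩⟩,
          rfl⟩
        · rw [← hlam.2, Λ.r_comp]
        · exact (Λ.comp_mem_lePaths_iff h m).mp hlam.1
      · intro a ha
        rw [Λ.s_comp]
    · push Not at hex
      rw [Λ.vLePaths_eq_singleton hv hex, Finset.coe_eq_singleton] at hF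
      rw [hF, Finset.sum_singleton, Λ.vertex_s v hv]
end

section
/- Let Λ be a k-graph and x an end of Λ. Then the image of x, namely the collection Λ(x) := {x(p,q) : p,q ∈ ℕ^k, p ≤ q ≤ d(x)} of morphisms (whose vertices are {x(p) : p ≤ d(x)}), is a subcategory of Λ, and (Λ(x), d restricted to Λ(x)) is itself a k-graph: Λ(x) is closed under composition in Λ, and the factorisation property holds within Λ(x). -/
open scoped BigOperators ENNReal NNReal

namespace KGraph

variable {k : ℕ} {Λ : KGraph k}

/-- Composition of paths of equal degrees is left cancellative. -/
theorem comp_left_cancel {μ ν ν' : Λ.Path} (h : Λ.s μ = Λ.r ν) (h' : Λ.s μ = Λ.r ν')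
    (hd : Λ.d ν = Λ.d ν') (hc : Λ.comp μ ν h = Λ.comp μ ν' h') : ν = ν' := by
  have huniq := (Λ.factor (Λ.comp μ ν' h') (Λ.d μ) (Λ.d ν') (Λ.d_comp μ ν' h')).unique
    (y₁ := (μ, ν)) (y₂ := (μ, ν')) ⟨h, rfl, hd, hc⟩ ⟨h', rfl, rfl, rfl⟩
  exact congrArg Prod.snd huniq

namespace IsEnd

variable {x : Λ.BoundaryPath} {q a b : Fin k → ℕ}

/-- If an end passes through the same vertex at `q` and at `a`, then its segment `x(a,b)` is also
the segment of the same degree starting at `q`. -/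
theorem seg_eq_of_add_le (hx : Λ.IsEnd x) (hab : a ≤ b) (hb : ∀ i, (b i : ℕ∞) ≤ x.deg i)
    (hv : x.seg q q = x.seg a a) (hq : ∀ i, ((q + (b - a)) i : ℕ∞) ≤ x.deg i) :
    x.seg a b = x.seg q (q + (b - a)) := by
  have hle : q ≤ q + (b - a) := le_self_add
  have hq' : ∀ i, (q i : ℕ∞) ≤ x.deg i := fun i =>
    (Nat.cast_le.mpr (hle i)).trans (hq i)
  have hs : Λ.s (x.seg 0 q) = x.seg q q := x.seg_s 0 q zero_le hq'
  have h : Λ.s (x.seg 0 q) = Λ.r (x.seg a b) := by rw [hs, x.seg_r a b hab hb, hv]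
  have h' : Λ.s (x.seg 0 q) = Λ.r (x.seg q (q + (b - a))) := by rw [hs, x.seg_r _ _ hle hq]
  have hmem : Λ.comp (x.seg 0 q) (x.seg a b) h ∈ Λ.paths (x.seg 0 0) (q + (b - a)) := by
    refine ⟨?_, ?_⟩
    · rw [Λ.d_comp, x.seg_d 0 q zero_le hq', x.seg_d a b hab hb, tsub_zero]
    · rw [Λ.r_comp, x.seg_r 0 q zero_le hq']
  rw [hx _ hq, Set.mem_singleton_iff, ← x.seg_comp 0 q _ zero_le hle hq h'] at hmem
  refine comp_left_cancel h h' ?_ hmem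
  rw [x.seg_d a b hab hb, x.seg_d _ _ hle hq, add_tsub_cancel_left]

/-- If an end passes through the same vertex at `q` and at `a`, then it can be followed from `q`
for at least the degree of any segment starting at `a`. -/
theorem add_le_deg (hx : Λ.IsEnd x) (hab : a ≤ b) (hb : ∀ i, (b i : ℕ∞) ≤ x.deg i)
    (hq : ∀ i, (q i : ℕ∞) ≤ x.deg i) (hv : x.seg q q = x.seg a a) :
    ∀ i, ((q + (b - a)) i : ℕ∞) ≤ x.deg i := by
  have hc : ∀ j, ∃ c : ℕ, a j + c ≤ b j ∧ ((q j + c : ℕ) : ℕ∞) ≤ x.deg j ∧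
      (a j + c = b j ∨ ((q j + c : ℕ) : ℕ∞) = x.deg j) := by
    intro j
    have h1 : a j ≤ b j := hab j
    have h2 := hq j
    by_cases h : ((q j + (b j - a j) : ℕ) : ℕ∞) ≤ x.deg j
    · exact ⟨b j - a j, by omega, h, Or.inl (by omega)⟩
    · obtain ⟨m, hm⟩ := ENat.ne_top_iff_exists.mp (not_le.mp h).ne_top
      rw [← hm, Nat.cast_le] at h h2
      refine ⟨m - q j, by omega, ?_⟩
      rw [← hm, Nat.cast_le, Nat.cast_inj]
      omega
  choose c hcb hcq hcor using hc
  intro i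
  have hac : a ≤ a + c := le_self_add
  have hqc : q ≤ q + c := le_self_add
  have hacb : a + c ≤ b := hcb
  have hac_deg : ∀ j, ((a + c) j : ℕ∞) ≤ x.deg j := fun j =>
    (Nat.cast_le.mpr (hacb j)).trans (hb j)
  have hseg : x.seg a (a + c) = x.seg q (q + c) := by
    have := hx.seg_eq_of_add_le hac hac_deg hv (by rwa [add_tsub_cancel_left])
    rwa [add_tsub_cancel_left] at this
  have hvertex : x.seg (a + c) (a + c) = x.seg (q + c) (q + c) := by
    rw [← x.seg_s a _ hac hac_deg, ← x.seg_s q _ hqc hcq, hseg]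
  by_cases hi : a i + c i = b i
  · have : (q + (b - a)) i = q i + c i := by
      simp only [Pi.add_apply, Pi.sub_apply]
      omega
    rw [this]
    exact hcq i
  · have hedge : a + c + Pi.single i 1 ≤ b := by
      intro j
      have hj := hcb j
      rcases eq_or_ne j i with rfl | hji
      · simp only [Pi.add_apply, Pi.single_eq_same]
        omega
      · simpa [hji] using hj
    have hedge_deg : ∀ j, ((a + c + Pi.single i 1 : Fin k → ℕ) j : ℕ∞) ≤ x.deg j := fun j =>
      (Nat.cast_le.mpr (hedge j)).trans (hb j)
    have hmem : x.seg (a + c) (a + c + Pi.single i 1) ∈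
        Λ.paths (x.seg (q + c) (q + c)) (Pi.single i 1) := by
      refine ⟨?_, ?_⟩
      · rw [x.seg_d _ _ le_self_add hedge_deg, add_tsub_cancel_left]
      · rw [x.seg_r _ _ le_self_add hedge_deg, hvertex]
    rw [x.boundary i (q + c) hcq ((hcor i).resolve_left hi)] at hmem
    exact hmem.elim

end IsEnd

end KGraph

/-- The image of an end is a subcategory of `Λ` which is itself a `k`-graph: it is
closed under range, source and composition, and satisfies the factorisation
property internally. -/
theorem end_image_is_sub_kgraph
    {k : ℕ} (Λ : KGraph k) (x : Λ.BoundaryPath) (hx : Λ.IsEnd x)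
    (Lx : Set Λ.Path)
    (hLx : Lx = {lam | ∃ (p q : Fin k → ℕ) (_ : p ≤ q)
      (_ : ∀ i, (q i : ℕ∞) ≤ x.deg i), lam = x.seg p q}) :
    (∀ lam ∈ Lx, Λ.r lam ∈ Lx ∧ Λ.s lam ∈ Lx) ∧
    (∀ (μ ν : Λ.Path) (h : Λ.s μ = Λ.r ν), μ ∈ Lx → ν ∈ Lx → Λ.comp μ ν h ∈ Lx) ∧
    (∀ lam ∈ Lx, ∀ m n : Fin k → ℕ, Λ.d lam = m + n →
      ∃ (μ ν : Λ.Path) (h : Λ.s μ = Λ.r ν), μ ∈ Lx ∧ ν ∈ Lx ∧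
        Λ.d μ = m ∧ Λ.d ν = n ∧ Λ.comp μ ν h = lam ∧
        ∀ (μ' ν' : Λ.Path) (h' : Λ.s μ' = Λ.r ν'),
          Λ.d μ' = m → Λ.d ν' = n → Λ.comp μ' ν' h' = lam → μ' = μ ∧ ν' = ν) := by
  subst hLx
  refine ⟨?_, ?_, ?_⟩
  · rintro _ ⟨p, q, hpq, hq, rfl⟩
    have hp : ∀ i, (p i : ℕ∞) ≤ x.deg i := fun i => (Nat.cast_le.mpr (hpq i)).trans (hq i)
    exact ⟨⟨p, p, le_rfl, hp, x.seg_r p q hpq hq⟩, ⟨q, q, le_rfl, hq, x.seg_s p q hpq hq⟩⟩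
  · rintro _ _ h ⟨p, q, hpq, hq, rfl⟩ ⟨a, b, hab, hb, rfl⟩
    have hv : x.seg q q = x.seg a a := by
      rw [← x.seg_s p q hpq hq, h, x.seg_r a b hab hb]
    have hdeg := hx.add_le_deg hab hb hq hv
    have hseg := hx.seg_eq_of_add_le hab hb hv hdeg
    refine ⟨p, q + (b - a), hpq.trans le_self_add, hdeg, ?_⟩
    simp only [hseg]
    exact x.seg_comp p q _ hpq le_self_add hdeg _
  · rintro _ ⟨p, q, hpq, hq, rfl⟩ m n hd
    rw [x.seg_d p q hpq hq] at hd
    have hqeq : p + m + n = q := by rw [add_assoc, ← hd, add_tsub_cancel_of_le hpq]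
    have hpm : p ≤ p + m := le_self_add
    have hmq : p + m ≤ q := hqeq ▸ le_self_add
    have hm : ∀ i, ((p + m) i : ℕ∞) ≤ x.deg i := fun i =>
      (Nat.cast_le.mpr (hmq i)).trans (hq i)
    have h : Λ.s (x.seg p (p + m)) = Λ.r (x.seg (p + m) q) := by
      rw [x.seg_s _ _ hpm hm, x.seg_r _ _ hmq hq]
    have hd₁ : Λ.d (x.seg p (p + m)) = m := by rw [x.seg_d _ _ hpm hm, add_tsub_cancel_left]
    have hd₂ : Λ.d (x.seg (p + m) q) = n := by
      rw [x.seg_d _ _ hmq hq, ← hqeq, add_tsub_cancel_left]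
    have hcomp := x.seg_comp p (p + m) q hpm hmq hq h
    refine ⟨_, _, h, ⟨p, p + m, hpm, hm, rfl⟩, ⟨p + m, q, hmq, hq, rfl⟩, hd₁, hd₂, hcomp, ?_⟩
    intro μ' ν' h' hμ' hν' hc'
    have huniq := (Λ.factor (x.seg p q) m n (by rw [x.seg_d p q hpq hq, hd])).unique
      (y₁ := (μ', ν')) (y₂ := (x.seg p (p + m), x.seg (p + m) q))
      ⟨h', hμ', hν', hc'⟩ ⟨h, hd₁, hd₂, hcomp⟩
    exact Prod.mk.inj huniq
end

section
/- Let Λ be a row-finite locally convex k-graph. A vertex v ∈ Λ⁰ lies on an end of Λ if and only if vΛ^{≤n} is a singleton for every n ∈ ℕ^k. -/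
open scoped BigOperators ENNReal NNReal

namespace KGraph

section Paths

variable {k : ℕ} (Λ : KGraph k)

theorem exists_factor (lam : Λ.Path) (m n : Fin k → ℕ) (h : Λ.d lam = m + n) :
    ∃ (μ ν : Λ.Path) (hc : Λ.s μ = Λ.r ν), Λ.d μ = m ∧ Λ.d ν = n ∧ Λ.comp μ ν hc = lam := by
  obtain ⟨⟨μ, ν⟩, ⟨hc, h1, h2, h3⟩, -⟩ := Λ.factor lam m n h
  exact ⟨μ, ν, hc, h1, h2, h3⟩

variable {Λ}

theorem comp_inj {μ ν μ' ν' : Λ.Path} (h : Λ.s μ = Λ.r ν) (h' : Λ.s μ' = Λ.r ν')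
    (hd : Λ.d μ = Λ.d μ') (hc : Λ.comp μ ν h = Λ.comp μ' ν' h') : μ = μ' ∧ ν = ν' := by
  have hdν : Λ.d ν = Λ.d ν' := by
    have := congrArg Λ.d hc
    rw [Λ.d_comp, Λ.d_comp, hd] at this
    exact add_left_cancel this
  have := (Λ.factor (Λ.comp μ ν h) (Λ.d μ) (Λ.d ν) (Λ.d_comp μ ν h)).unique
    (y₁ := (μ, ν)) (y₂ := (μ', ν')) ⟨h, rfl, rfl, rfl⟩ ⟨h', hd.symm, hdν.symm, hc.symm⟩
  exact Prod.ext_iff.1 this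

theorem eq_r_of_d_eq_zero {μ : Λ.Path} (h : Λ.d μ = 0) : μ = Λ.r μ :=
  (Λ.vertex_r μ h).symm

theorem r_s (lam : Λ.Path) : Λ.r (Λ.s lam) = Λ.s lam :=
  Λ.vertex_r _ (Λ.d_s lam)

/-- Every path of degree at most `n` extends to an element of `Λ^{≤ n}`. -/
theorem exists_comp_mem_lePaths (n : Fin k → ℕ) (lam : Λ.Path) (hle : Λ.d lam ≤ n) :
    ∃ (μ : Λ.Path) (h : Λ.s lam = Λ.r μ), Λ.comp lam μ h ∈ Λ.lePaths n := by
  induction hN : ∑ i, (n i - Λ.d lam i) using Nat.strong_induction_on generalizing lam with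
  | _ N ih =>
    by_cases hmem : lam ∈ Λ.lePaths n
    · exact ⟨Λ.s lam, (r_s lam).symm, by rwa [Λ.comp_id]⟩
    · simp only [lePaths, Set.mem_ofPred_eq, not_and, not_forall] at hmem
      obtain ⟨μ, hμ, hdμ, hne⟩ := hmem hle
      obtain ⟨i, hi⟩ : ∃ i, Λ.d μ i ≠ 0 := by
        by_contra! hall
        exact hne ((eq_r_of_d_eq_zero (funext hall)).trans hμ.symm)
      have hlt : ∑ i, (n i - Λ.d (Λ.comp lam μ hμ) i) < N := by
        rw [← hN, Λ.d_comp]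
        refine Finset.sum_lt_sum (fun j _ => ?_) ⟨i, Finset.mem_univ i, ?_⟩
        · simp only [Pi.add_apply]; omega
        · have := hdμ i
          simp only [Pi.add_apply] at this ⊢
          omega
      obtain ⟨ν, hν, hmem'⟩ := ih _ hlt (Λ.comp lam μ hμ) (by rwa [Λ.d_comp]) rfl
      have hμν : Λ.s μ = Λ.r ν := by rw [← hν, Λ.s_comp]
      have hc : Λ.s lam = Λ.r (Λ.comp μ ν hμν) := by rw [Λ.r_comp, hμ]
      exact ⟨Λ.comp μ ν hμν, hc, by rwa [← Λ.comp_assoc lam μ ν hμ hμν hν hc]⟩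

/-- A path whose degree is positive in direction `i` starts with an edge in direction `i`. -/
theorem paths_single_nonempty {μ : Λ.Path} {i : Fin k} (hi : Λ.d μ i ≠ 0) :
    (Λ.paths (Λ.r μ) (Pi.single i 1)).Nonempty := by
  have hle : Pi.single i 1 ≤ Λ.d μ := by
    intro j
    by_cases hj : j = i
    · subst hj; simp; omega
    · simp [hj]
  obtain ⟨e, ν, hc, he, -, rfl⟩ :=
    Λ.exists_factor μ (Pi.single i 1) (Λ.d μ - Pi.single i 1) (add_tsub_cancel_of_le hle).symm
  exact ⟨e, he, (Λ.r_comp e ν hc).symm⟩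

theorem mem_vLePaths_of_mem_paths {v lam : Λ.Path} {n : Fin k → ℕ} (h : lam ∈ Λ.paths v n) :
    lam ∈ Λ.vLePaths v n := by
  obtain ⟨rfl, hr⟩ := h
  refine ⟨⟨le_rfl, fun μ hμ hle => ?_⟩, hr⟩
  have : Λ.d μ = 0 := funext fun i => by
    have := hle i
    simp only [Pi.add_apply] at this
    simpa using this
  exact (eq_r_of_d_eq_zero this).trans hμ.symm

theorem paths_nonempty_of_le {v : Λ.Path} {m n : Fin k → ℕ} (hmn : m ≤ n)
    (h : (Λ.paths v n).Nonempty) : (Λ.paths v m).Nonempty := by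
  obtain ⟨lam, hd, hr⟩ := h
  obtain ⟨μ, ν, hc, hμ, -, rfl⟩ :=
    Λ.exists_factor lam m (n - m) (hd.trans (add_tsub_cancel_of_le hmn).symm)
  exact ⟨μ, hμ, by rw [← hr, Λ.r_comp]⟩

theorem paths_sup_nonempty {v : Λ.Path} {m n : Fin k → ℕ}
    (hv : ∃! lam, lam ∈ Λ.vLePaths v (m ⊔ n))
    (hm : (Λ.paths v m).Nonempty) (hn : (Λ.paths v n).Nonempty) :
    (Λ.paths v (m ⊔ n)).Nonempty := by
  obtain ⟨lam, hlam, huniq⟩ := hv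
  have key : ∀ p, p ≤ m ⊔ n → (Λ.paths v p).Nonempty → p ≤ Λ.d lam := by
    rintro p hp ⟨α, hd, hr⟩
    obtain ⟨μ, h, hmem⟩ := exists_comp_mem_lePaths (m ⊔ n) α (hd.trans_le hp)
    rw [← huniq _ ⟨hmem, (Λ.r_comp _ _ _).trans hr⟩, Λ.d_comp, hd]
    exact le_self_add
  exact ⟨lam, le_antisymm hlam.1.1 (sup_le (key m le_sup_left hm) (key n le_sup_right hn)),
    hlam.2⟩

end Paths

/-- A nonempty directed lower set in `ℕ^k` consists of the elements below some `D ∈ (ℕ ∪ {∞})^k`. -/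
theorem exists_forall_mem_iff_le {k : ℕ} (S : Set (Fin k → ℕ)) (h0 : (0 : Fin k → ℕ) ∈ S)
    (hsup : ∀ m ∈ S, ∀ n ∈ S, m ⊔ n ∈ S) (hlow : ∀ m n, m ≤ n → n ∈ S → m ∈ S) :
    ∃ D : Fin k → ℕ∞, ∀ n, n ∈ S ↔ ∀ i, (n i : ℕ∞) ≤ D i := by
  refine ⟨fun i => ⨆ n ∈ S, (n i : ℕ∞), fun n => ⟨fun hn i => ?_, fun hn => ?_⟩⟩
  · exact le_iSup₂ (f := fun (n : Fin k → ℕ) (_ : n ∈ S) => (n i : ℕ∞)) n hn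
  · have hex : ∀ i, ∃ m ∈ S, n i ≤ m i := by
      intro i
      by_contra! hlt
      have hpos := hlt 0 h0
      have hle : (⨆ m ∈ S, (m i : ℕ∞)) ≤ ((n i - 1 : ℕ) : ℕ∞) :=
        iSup₂_le fun m hm => by
          have := hlt m hm
          exact_mod_cast (by omega : m i ≤ n i - 1)
      have := (hn i).trans hle
      have : n i ≤ n i - 1 := by exact_mod_cast this
      omega
    choose m hm hnm using hex
    have hfin : ∀ s : Finset (Fin k), s.sup m ∈ S := fun s =>
      Finset.sup_induction (p := (· ∈ S)) h0 hsup (fun i _ => hm i)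
    exact hlow _ _ (fun i => (hnm i).trans (Finset.le_sup (f := m) (Finset.mem_univ i) i))
      (hfin Finset.univ)

/-- Truncating `n + m` at `D ∈ (ℕ ∪ {∞})^k`. -/
theorem exists_truncation {k : ℕ} {D : Fin k → ℕ∞} {n : Fin k → ℕ}
    (hn : ∀ i, (n i : ℕ∞) ≤ D i) (m : Fin k → ℕ) :
    ∃ N : Fin k → ℕ, N ≤ m ∧ (∀ i, ((n + N) i : ℕ∞) ≤ D i) ∧
      ∀ i, N i = m i ∨ ((n + N) i : ℕ∞) = D i := by
  have hex : ∀ i, ∃ a : ℕ, a ≤ m i ∧ ((n i + a : ℕ) : ℕ∞) ≤ D i ∧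
      (a = m i ∨ ((n i + a : ℕ) : ℕ∞) = D i) := by
    intro i
    rcases le_total ((n i + m i : ℕ) : ℕ∞) (D i) with h | h
    · exact ⟨m i, le_rfl, h, Or.inl rfl⟩
    · obtain ⟨b, hb⟩ := ENat.ne_top_iff_exists.1 (ne_top_of_le_ne_top (ENat.natCast_ne_top _) h)
      have h1 := hn i
      rw [← hb] at h h1 ⊢
      norm_cast at h h1 ⊢
      exact ⟨b - n i, by omega, by omega, Or.inr (by omega)⟩
  choose N h1 h2 h3 using hex
  exact ⟨N, h1, h2, h3⟩

variable {k : ℕ} {Λ : KGraph k}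

/-- Paths starting at a vertex of an end follow that end. -/
theorem IsEnd.eq_seg {x : Λ.BoundaryPath} (hx : Λ.IsEnd x) {n m : Fin k → ℕ}
    (hnm : ∀ i, ((n + m) i : ℕ∞) ≤ x.deg i) {lam : Λ.Path}
    (h : lam ∈ Λ.paths (x.seg n n) m) : lam = x.seg n (n + m) := by
  have hn : ∀ i, (n i : ℕ∞) ≤ x.deg i := fun i =>
    le_trans (by exact_mod_cast (Nat.le_add_right (n i) (m i))) (hnm i)
  have hle : n ≤ n + m := le_self_add
  have h0 : (0 : Fin k → ℕ) ≤ n := zero_le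
  have hc : Λ.s (x.seg 0 n) = Λ.r lam := (x.seg_s 0 n h0 hn).trans h.2.symm
  have hc' : Λ.s (x.seg 0 n) = Λ.r (x.seg n (n + m)) :=
    (x.seg_s 0 n h0 hn).trans (x.seg_r n _ hle hnm).symm
  have hmem : Λ.comp (x.seg 0 n) lam hc ∈ Λ.paths (x.seg 0 0) (n + m) :=
    ⟨by rw [Λ.d_comp, x.seg_d 0 n h0 hn, h.1, tsub_zero],
      by rw [Λ.r_comp, x.seg_r 0 n h0 hn]⟩
  rw [hx _ hnm, Set.mem_singleton_iff] at hmem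
  exact (comp_inj hc hc' rfl (hmem.trans (x.seg_comp 0 n _ h0 hle hnm hc').symm)).2

/-- Paths starting at a vertex of an end do not leave the degree of that end. -/
theorem IsEnd.add_d_le {x : Λ.BoundaryPath} (hx : Λ.IsEnd x) {n : Fin k → ℕ}
    (hn : ∀ i, (n i : ℕ∞) ≤ x.deg i) {lam : Λ.Path} (hr : Λ.r lam = x.seg n n) (i : Fin k) :
    ((n + Λ.d lam) i : ℕ∞) ≤ x.deg i := by
  obtain ⟨N, hN, hNdeg, hNeq⟩ : ∃ N : Fin k → ℕ, N ≤ Λ.d lam ∧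
      (∀ i, ((n + N) i : ℕ∞) ≤ x.deg i) ∧
      ∀ i, N i = Λ.d lam i ∨ ((n + N) i : ℕ∞) = x.deg i :=
    exists_truncation hn (Λ.d lam)
  obtain ⟨μ, ν, hc, hμ, hν, hlam⟩ :=
    Λ.exists_factor lam N (Λ.d lam - N) (add_tsub_cancel_of_le hN).symm
  have hμr : μ ∈ Λ.paths (x.seg n n) N := ⟨hμ, by rw [← hr, ← hlam, Λ.r_comp]⟩
  have hμeq := hx.eq_seg hNdeg hμr
  have hνr : Λ.r ν = x.seg (n + N) (n + N) := by
    rw [← hc, hμeq, x.seg_s n (n + N) le_self_add hNdeg]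
  rcases hNeq i with h | h
  · have := hNdeg i
    simpa [h] using this
  · have hempty := x.boundary i (n + N) hNdeg h
    have hz : Λ.d ν i = 0 := by
      by_contra hi
      have := paths_single_nonempty hi
      rw [hνr, hempty] at this
      exact Set.not_nonempty_empty this
    have h1 := hNdeg i
    have h2 : Λ.d lam i = N i := by
      have : N i ≤ Λ.d lam i := hN i
      rw [hν, Pi.sub_apply] at hz
      omega
    simpa [h2] using h1

theorem IsEnd.existsUnique_mem_vLePaths {x : Λ.BoundaryPath} (hx : Λ.IsEnd x) {n : Fin k → ℕ}
    (hn : ∀ i, (n i : ℕ∞) ≤ x.deg i) (m : Fin k → ℕ) :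
    ∃! lam, lam ∈ Λ.vLePaths (x.seg n n) m := by
  obtain ⟨N, hN, hNdeg, hNeq⟩ := exists_truncation hn m
  have hle : n ≤ n + N := le_self_add
  have hdeg : ∀ lam ∈ Λ.vLePaths (x.seg n n) m, Λ.d lam = N := by
    rintro lam ⟨⟨hlm, hmax⟩, hr⟩
    have hlx := hx.add_d_le hn hr
    have hlN : Λ.d lam ≤ N := fun i => by
      rcases hNeq i with h | h
      · exact (hlm i).trans h.ge
      · have : ((n + Λ.d lam) i : ℕ∞) ≤ ((n + N) i : ℕ) := (hlx i).trans h.ge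
        have : (n + Λ.d lam) i ≤ (n + N) i := by exact_mod_cast this
        simpa using this
    have hlam := hx.eq_seg hlx ⟨rfl, hr⟩
    have hstep : n + Λ.d lam ≤ n + N := by gcongr
    have hsr : Λ.s lam = Λ.r (x.seg (n + Λ.d lam) (n + N)) := by
      rw [x.seg_r _ _ hstep hNdeg, ← x.seg_s n _ le_self_add hlx, ← hlam]
    have hd := x.seg_d _ _ hstep hNdeg
    rw [add_tsub_add_eq_tsub_left] at hd
    have heq := hmax _ hsr (by rw [hd, add_tsub_cancel_of_le hlN]; exact hN)
    rw [heq, Λ.d_s] at hd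
    exact le_antisymm hlN (tsub_eq_zero_iff_le.1 hd.symm)
  obtain ⟨μ, hc, hμ⟩ := exists_comp_mem_lePaths m (x.seg n n)
    (by rw [x.seg_d n n le_rfl hn, tsub_self]; exact zero_le)
  have huniq : ∀ lam ∈ Λ.vLePaths (x.seg n n) m, lam = x.seg n (n + N) := fun lam h =>
    hx.eq_seg hNdeg ⟨hdeg lam h, h.2⟩
  have hmem : Λ.comp (x.seg n n) μ hc ∈ Λ.vLePaths (x.seg n n) m :=
    ⟨hμ, by rw [Λ.r_comp, x.seg_r n n le_rfl hn]⟩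
  exact ⟨_, hmem, fun lam h => (huniq lam h).trans (huniq _ hmem).symm⟩

/-- If every `vΛ^{≤ n}` is a singleton, then `v` is the range of an end. -/
theorem exists_isEnd_of_existsUnique {v : Λ.Path} (hv : Λ.IsVertex v)
    (h : ∀ n : Fin k → ℕ, ∃! lam, lam ∈ Λ.vLePaths v n) :
    ∃ x : Λ.BoundaryPath, Λ.IsEnd x ∧ x.seg 0 0 = v := by
  have h0 : (Λ.paths v 0).Nonempty := ⟨v, hv, Λ.vertex_r v hv⟩
  obtain ⟨D, hD⟩ := exists_forall_mem_iff_le {n | (Λ.paths v n).Nonempty} h0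
    (fun m hm n hn => paths_sup_nonempty (h _) hm hn) (fun m n => paths_nonempty_of_le)
  simp only [Set.mem_ofPred_eq] at hD
  have huniq : ∀ {n α β}, α ∈ Λ.paths v n → β ∈ Λ.paths v n → α = β := fun hα hβ =>
    (h _).unique (mem_vLePaths_of_mem_paths hα) (mem_vLePaths_of_mem_paths hβ)
  have hex : ∀ n, ∃ lam, (∀ i, (n i : ℕ∞) ≤ D i) → lam ∈ Λ.paths v n := fun n => by
    by_cases hn : (Λ.paths v n).Nonempty
    · exact ⟨hn.some, fun _ => hn.some_mem⟩
    · exact ⟨v, fun hn' => absurd ((hD n).2 hn') hn⟩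
  choose pth hpth using hex
  have hmono : ∀ {p q : Fin k → ℕ}, p ≤ q → (∀ i, (q i : ℕ∞) ≤ D i) →
      ∀ i, (p i : ℕ∞) ≤ D i := fun hpq hq i =>
    le_trans (by exact_mod_cast hpq i) (hq i)
  have hseg : ∀ p q : Fin k → ℕ, ∃ ν, p ≤ q → (∀ i, (q i : ℕ∞) ≤ D i) →
      ∃ hc : Λ.s (pth p) = Λ.r ν, Λ.d ν = q - p ∧ Λ.comp (pth p) ν hc = pth q := by
    intro p q
    by_cases hpq : p ≤ q ∧ ∀ i, (q i : ℕ∞) ≤ D i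
    · obtain ⟨hpq, hq⟩ := hpq
      obtain ⟨μ, ν, hc, hμ, hν, hcomp⟩ := Λ.exists_factor (pth q) p (q - p)
        ((hpth q hq).1.trans (add_tsub_cancel_of_le hpq).symm)
      have hμp : μ = pth p := huniq ⟨hμ, by rw [← (hpth q hq).2, ← hcomp, Λ.r_comp]⟩
        (hpth p (hmono hpq hq))
      subst hμp
      exact ⟨ν, fun _ _ => ⟨hc, hν, hcomp⟩⟩
    · exact ⟨v, fun h1 h2 => absurd ⟨h1, h2⟩ hpq⟩
  choose seg hseg using hseg
  have hsegp : ∀ p, (∀ i, (p i : ℕ∞) ≤ D i) → seg p p = Λ.s (pth p) := fun p hp => by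
    obtain ⟨hc, hd, -⟩ := hseg p p le_rfl hp
    rw [tsub_self] at hd
    exact (eq_r_of_d_eq_zero hd).trans hc.symm
  have hpth0 : pth 0 = v := huniq (hpth 0 ((hD 0).1 h0)) ⟨hv, Λ.vertex_r v hv⟩
  have hsv : Λ.s v = v := Λ.vertex_s v hv
  have hseg00 : seg 0 0 = v := by rw [hsegp 0 ((hD 0).1 h0), hpth0, hsv]
  have hs : ∀ p q : Fin k → ℕ, p ≤ q → (∀ i, (q i : ℕ∞) ≤ D i) →
      Λ.s (seg p q) = Λ.s (pth q) := fun p q hpq hq => by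
    obtain ⟨hc, -, hcomp⟩ := hseg p q hpq hq
    rw [← hcomp, Λ.s_comp]
  refine ⟨{ deg := D, seg := seg, seg_d := ?_, seg_r := ?_, seg_s := ?_, seg_comp := ?_,
            boundary := ?_ }, ?_, hseg00⟩
  · intro p q hpq hq
    exact (hseg p q hpq hq).2.1
  · intro p q hpq hq
    rw [hsegp p (hmono hpq hq), (hseg p q hpq hq).1]
  · intro p q hpq hq
    rw [hsegp q hq, hs p q hpq hq]
  · intro p q t hpq hqt ht hc
    obtain ⟨h1, -, hc1⟩ := hseg p q hpq (hmono hqt ht)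
    obtain ⟨h2, -, hc2⟩ := hseg q t hqt ht
    obtain ⟨h3, -, hc3⟩ := hseg p t (hpq.trans hqt) ht
    have h4 : Λ.s (Λ.comp (pth p) (seg p q) h1) = Λ.r (seg q t) := by rw [Λ.s_comp, hc]
    have h5 : Λ.s (pth p) = Λ.r (Λ.comp (seg p q) (seg q t) hc) := by rw [Λ.r_comp, h1]
    refine (comp_inj h5 h3 rfl ?_).2
    rw [← Λ.comp_assoc _ _ _ h1 hc h4 h5, hc3, ← hc2]
    congr 1
  · intro i n hn hni
    rw [Set.eq_empty_iff_forall_notMem]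
    rintro e ⟨hde, hre⟩
    have hc : Λ.s (pth n) = Λ.r e := by rw [hre, hsegp n hn]
    have hle := (hD (n + Pi.single i 1)).1
      ⟨Λ.comp (pth n) e hc, by rw [Λ.d_comp, hde, (hpth n hn).1],
        by rw [Λ.r_comp, (hpth n hn).2]⟩ i
    rw [← hni] at hle
    have : (n + Pi.single i 1 : Fin k → ℕ) i ≤ n i := by exact_mod_cast hle
    simp at this
  · intro n hn
    change Λ.paths (seg 0 0) n = {seg 0 n}
    have hmem : seg 0 n ∈ Λ.paths v n := by
      obtain ⟨hc, hd, -⟩ := hseg 0 n zero_le hn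
      exact ⟨by rw [hd, tsub_zero], by rw [← hc, hpth0, hsv]⟩
    rw [hseg00]
    exact Set.eq_singleton_iff_unique_mem.2 ⟨hmem, fun α hα => huniq hα hmem⟩

end KGraph

/-- A vertex lies on an end iff `vΛ^{≤n}` is a singleton for every `n`. -/
theorem lies_on_end_iff_vLePaths_singleton
    {k : ℕ} (Λ : KGraph k) (hrf : Λ.RowFinite) (hlc : Λ.LocallyConvex)
    (v : Λ.Path) (hv : Λ.IsVertex v) :
    (∃ x : Λ.BoundaryPath, Λ.IsEnd x ∧ Λ.LiesOn v x) ↔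
      ∀ n : Fin k → ℕ, ∃! lam : Λ.Path, lam ∈ Λ.vLePaths v n := by
  constructor
  · rintro ⟨x, hx, n, hn, rfl⟩
    exact hx.existsUnique_mem_vLePaths hn
  · intro h
    obtain ⟨x, hx, hx0⟩ := KGraph.exists_isEnd_of_existsUnique hv h
    exact ⟨x, hx, 0, fun i => by simp, hx0.symm⟩
end
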